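/- Define h₂: ℝ → ℝ by h₂(t) = (4/3)·∫_ℝ sinc(π(t−s))^3 · sgn(s) ds, where sinc(t) = sin(t)/t for t ≠ 0, sinc(0) = 1, and sgn(s) = 1 for s ≥ 0 and sgn(s) = −1 for s < 0. Then h₂ is well defined (the integrand is integrable for every t), h₂ is an odd function, and h₂(t) → 1 as t → +∞. -/

import Mathlib

open MeasureTheory Filter

/-- `sinc t = sin t / t` for `t ≠ 0`, `sinc 0 = 1`. -/
noncomputable def sinc (t : ℝ) : ℝ := if t = 0 then 1 else Real.sin t / t

/-- `sgn s = 1` for `s ≥ 0`, `sgn s = −1` for `s < 0`. -/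
noncomputable def sgn (s : ℝ) : ℝ := if 0 ≤ s then 1 else -1

/-- The normalizing function `h₂(t) = (4/3)·∫ sinc(π(t−s))^3 sgn(s) ds`. -/
noncomputable def h₂ (t : ℝ) : ℝ :=
  (4 / 3) * ∫ s : ℝ, sinc (Real.pi * (t - s)) ^ 3 * sgn s

open scoped FourierTransform

theorem sinc_eq_real_sinc : sinc = Real.sinc := rfl

theorem sinc_sq_mul_one_add_sq_le (x : ℝ) : sinc x ^ 2 * (1 + x ^ 2) ≤ 2 := by
  have h1 : sinc x ^ 2 ≤ 1 := (sq_le_one_iff_abs_le_one _).2 (Real.abs_sinc_le_one x)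
  have h2 : sinc x * x = Real.sin x := by
    by_cases hx : x = 0
    · simp [hx]
    · simp [sinc, hx]
  have h3 : (sinc x * x) ^ 2 ≤ 1 := by
    rw [h2]
    exact Real.sin_sq_le_one x
  nlinarith

theorem integrable_sinc_pi_mul_pow {n : ℕ} (hn : 2 ≤ n) :
    Integrable (fun u : ℝ => sinc (Real.pi * u) ^ n) := by
  refine Integrable.mono' (g := fun u : ℝ => 2 * (1 + (Real.pi * u) ^ 2)⁻¹)
    ((integrable_inv_one_add_sq.comp_mul_left' Real.pi_ne_zero).const_mul 2)
    ((Real.continuous_sinc.comp (continuous_const.mul continuous_id)).pow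
      n).aestronglyMeasurable (ae_of_all _ fun u => ?_)
  rw [Real.norm_eq_abs, abs_pow]
  calc |sinc (Real.pi * u)| ^ n ≤ |sinc (Real.pi * u)| ^ 2 :=
        pow_le_pow_of_le_one (abs_nonneg _) (Real.abs_sinc_le_one _) hn
    _ = sinc (Real.pi * u) ^ 2 := sq_abs _
    _ ≤ 2 * (1 + (Real.pi * u) ^ 2)⁻¹ := by
        rw [← div_eq_mul_inv, le_div_iff₀ (by positivity)]
        exact sinc_sq_mul_one_add_sq_le _

theorem exp_sub_exp_div_eq_sinc {ξ : ℝ} (hξ : ξ ≠ 0) :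
    (Complex.exp ((-2 * Real.pi * ξ * Complex.I) / 2)
      - Complex.exp (-((-2 * Real.pi * ξ * Complex.I) / 2))) / (-2 * Real.pi * ξ * Complex.I)
      = (sinc (Real.pi * ξ) : ℝ) := by
  have hpi : (Real.pi : ℂ) ≠ 0 := by exact_mod_cast Real.pi_ne_zero
  have hξ' : (ξ : ℂ) ≠ 0 := by exact_mod_cast hξ
  have h1 : (-2 * Real.pi * ξ * Complex.I) / 2 = -((Real.pi * ξ : ℂ) * Complex.I) := by ring
  rw [h1, neg_neg, ← neg_mul, Complex.exp_mul_I, Complex.exp_mul_I, Complex.cos_neg,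
    Complex.sin_neg, sinc, if_neg (mul_ne_zero Real.pi_ne_zero hξ)]
  push_cast
  field_simp
  ring

/-- The Fourier transform of the indicator function of the unit interval. -/
theorem fourier_indicator_unit_interval {ξ : ℝ} (hξ : ξ ≠ 0) :
    𝓕 ((Set.Ioc (-(1 / 2) : ℝ) (1 / 2)).indicator (fun _ => (1 : ℂ))) ξ
      = (sinc (Real.pi * ξ) : ℝ) := by
  have hc : (-2 * Real.pi * ξ * Complex.I : ℂ) ≠ 0 := by
    simp [hξ, Real.pi_ne_zero]
  rw [Real.fourier_real_eq_integral_exp_smul, ← exp_sub_exp_div_eq_sinc hξ]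
  have h : ∀ v : ℝ, Complex.exp (((-2 * Real.pi * v * ξ : ℝ) : ℂ) * Complex.I) •
      (Set.Ioc (-(1 / 2) : ℝ) (1 / 2)).indicator (fun _ => (1 : ℂ)) v
      = (Set.Ioc (-(1 / 2) : ℝ) (1 / 2)).indicator
        (fun v : ℝ => Complex.exp ((-2 * Real.pi * ξ * Complex.I) * v)) v := by
    intro v
    by_cases hv : v ∈ Set.Ioc (-(1 / 2) : ℝ) (1 / 2)
    · simp only [Set.indicator_of_mem hv, smul_eq_mul, mul_one]
      congr 1
      push_cast
      ring
    · simp only [Set.indicator_of_notMem hv, smul_zero]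
  simp_rw [h]
  rw [integral_indicator measurableSet_Ioc, ← intervalIntegral.integral_of_le (by norm_num),
    integral_exp_mul_complex hc]
  congr 3 <;> push_cast <;> ring_nf

/-- The triangle function, supported on `[-1, 1]`. -/
noncomputable def triangle (v : ℝ) : ℂ := (max 0 (1 - |v|) : ℝ)

theorem continuous_triangle : Continuous triangle := by
  unfold triangle
  fun_prop

theorem triangle_neg (v : ℝ) : triangle (-v) = triangle v := by
  simp [triangle]

theorem triangle_eq_zero_of_notMem {v : ℝ} (hv : v ∉ Set.Ioc (-1 : ℝ) 1) : triangle v = 0 := by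
  have : 1 ≤ |v| := by
    by_contra! h
    exact hv ⟨(abs_lt.1 h).1, (abs_lt.1 h).2.le⟩
  simp [triangle, this]

theorem triangle_of_nonneg {v : ℝ} (h0 : 0 ≤ v) (h1 : v ≤ 1) : triangle v = 1 - v := by
  rw [triangle, abs_of_nonneg h0, max_eq_right (by linarith)]
  push_cast
  rfl

theorem triangle_of_nonpos {v : ℝ} (h0 : -1 ≤ v) (h1 : v ≤ 0) : triangle v = 1 + v := by
  rw [← triangle_neg, triangle_of_nonneg (by linarith) (by linarith)]
  push_cast
  ring

theorem integrable_triangle : Integrable triangle :=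
  continuous_triangle.integrable_of_hasCompactSupport <|
    HasCompactSupport.intro (K := Set.Icc (-1) 1) isCompact_Icc fun _ hv =>
      triangle_eq_zero_of_notMem fun h => hv ⟨h.1.le, h.2⟩

theorem integral_exp_mul_triangle {c : ℂ} (hc : c ≠ 0) :
    ∫ v : ℝ in (-1)..1, Complex.exp (c * v) * triangle v
      = ((Complex.exp (c / 2) - Complex.exp (-(c / 2))) / c) ^ 2 := by
  have hcont : Continuous fun v : ℝ => Complex.exp (c * v) * triangle v := by
    have := continuous_triangle
    fun_prop
  have hexp (x : ℝ) : HasDerivAt (fun v : ℝ => Complex.exp (c * v)) (Complex.exp (c * x) * c) x := by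
    simpa using ((Complex.ofRealCLM.hasDerivAt (x := x)).const_mul c).cexp
  have hid (x : ℝ) : HasDerivAt (fun v : ℝ => (v : ℂ)) 1 x := Complex.ofRealCLM.hasDerivAt
  have hr : ∫ v : ℝ in 0..1, Complex.exp (c * v) * triangle v
      = Complex.exp c / c ^ 2 - 1 / c - 1 / c ^ 2 := by
    rw [intervalIntegral.integral_eq_sub_of_hasDerivAt
      (f := fun v : ℝ => Complex.exp (c * v) * ((1 - v) / c + 1 / c ^ 2)) _
      (hcont.intervalIntegrable _ _)]
    · simp
      ring
    · intro x hx
      rw [Set.uIcc_of_le zero_le_one] at hx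
      rw [triangle_of_nonneg hx.1 hx.2]
      refine ((hexp x).mul ((((hid x).const_sub 1).div_const c).add_const (1 / c ^ 2))).congr_deriv ?_
      field_simp
      ring
  have hl : ∫ v : ℝ in (-1)..0, Complex.exp (c * v) * triangle v
      = 1 / c - 1 / c ^ 2 + Complex.exp (-c) / c ^ 2 := by
    rw [intervalIntegral.integral_eq_sub_of_hasDerivAt
      (f := fun v : ℝ => Complex.exp (c * v) * ((1 + v) / c - 1 / c ^ 2)) _
      (hcont.intervalIntegrable _ _)]
    · simp
      ring
    · intro x hx
      rw [Set.uIcc_of_le (by norm_num)] at hx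
      rw [triangle_of_nonpos hx.1 hx.2]
      refine ((hexp x).mul ((((hid x).const_add 1).div_const c).sub_const (1 / c ^ 2))).congr_deriv ?_
      field_simp
      ring
  rw [← intervalIntegral.integral_add_adjacent_intervals (hcont.intervalIntegrable (-1) 0)
    (hcont.intervalIntegrable 0 1), hr, hl]
  have h1 : Complex.exp c = Complex.exp (c / 2) ^ 2 := by
    rw [← Complex.exp_nat_mul]
    congr 1
    push_cast
    ring
  have h2 : Complex.exp (-c) = Complex.exp (-(c / 2)) ^ 2 := by
    rw [← Complex.exp_nat_mul]
    congr 1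
    push_cast
    ring
  have h3 : Complex.exp (c / 2) * Complex.exp (-(c / 2)) = 1 := by
    rw [← Complex.exp_add]
    simp
  rw [h1, h2]
  field_simp
  linear_combination 2 * h3

theorem fourier_triangle {ξ : ℝ} (hξ : ξ ≠ 0) :
    𝓕 triangle ξ = (sinc (Real.pi * ξ) ^ 2 : ℝ) := by
  have hc : (-2 * Real.pi * ξ * Complex.I : ℂ) ≠ 0 := by
    simp [hξ, Real.pi_ne_zero]
  rw [Complex.ofReal_pow, ← exp_sub_exp_div_eq_sinc hξ, ← integral_exp_mul_triangle hc,
    Real.fourier_real_eq_integral_exp_smul, intervalIntegral.integral_of_le (by norm_num),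
    ← integral_indicator measurableSet_Ioc]
  congr 1 with v
  by_cases hv : v ∈ Set.Ioc (-1 : ℝ) 1
  · rw [Set.indicator_of_mem hv, smul_eq_mul]
    congr 2
    push_cast
    ring
  · rw [Set.indicator_of_notMem hv, triangle_eq_zero_of_notMem hv, smul_zero]

theorem integrable_fourier_triangle : Integrable (𝓕 triangle) := by
  refine (integrable_sinc_pi_mul_pow le_rfl).ofReal.congr ?_
  filter_upwards [Measure.ae_ne volume (0 : ℝ)] with ξ hξ
  exact (fourier_triangle hξ).symm

theorem fourier_fourier_triangle (v : ℝ) : 𝓕 (𝓕 triangle) v = triangle v := by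
  have h := congrFun (continuous_triangle.fourierInv_fourier_eq integrable_triangle
    integrable_fourier_triangle) (-v)
  rwa [Real.fourierInv_eq_fourier_neg, neg_neg, triangle_neg] at h

theorem integral_triangle_center :
    ∫ v : ℝ in (-(1 / 2))..(1 / 2), triangle v = 3 / 4 := by
  have hi := fun a b => continuous_triangle.intervalIntegrable (μ := volume) a b
  have hr : ∫ v : ℝ in 0..(1 / 2), triangle v = 3 / 8 := by
    rw [intervalIntegral.integral_congr (g := fun v : ℝ => ((1 - v : ℝ) : ℂ)),
      intervalIntegral.integral_ofReal]
    · rw [intervalIntegral.integral_sub (by simp) (by simp)]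
      norm_num
    · intro v hv
      rw [Set.uIcc_of_le (by norm_num)] at hv
      simp only [triangle_of_nonneg hv.1 (by linarith [hv.2])]
      push_cast
      rfl
  have hl : ∫ v : ℝ in (-(1 / 2))..0, triangle v = 3 / 8 := by
    rw [← hr, ← neg_zero, ← intervalIntegral.integral_comp_neg]
    simp only [triangle_neg, neg_zero]
  rw [← intervalIntegral.integral_add_adjacent_intervals (hi _ 0) (hi 0 _), hl, hr]
  norm_num

theorem integral_sinc_pi_mul_cube : ∫ u : ℝ, sinc (Real.pi * u) ^ 3 = 3 / 4 := by
  have hbox : Integrable ((Set.Ioc (-(1 / 2) : ℝ) (1 / 2)).indicator (fun _ => (1 : ℂ))) :=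
    (integrable_indicator_iff measurableSet_Ioc).2 (integrableOn_const (by simp))
  have hflip := VectorFourier.integral_fourierIntegral_smul_eq_flip (L := innerₗ ℝ)
    (μ := volume) (ν := volume) Real.continuous_fourierChar continuous_inner
    integrable_fourier_triangle hbox
  rw [flip_innerₗ] at hflip
  change ∫ ξ, 𝓕 (𝓕 triangle) ξ • _ = ∫ x, 𝓕 triangle x • 𝓕 ((Set.Ioc (-(1 / 2) : ℝ)
    (1 / 2)).indicator (fun _ => (1 : ℂ))) x at hflip
  have hl : ∫ ξ, 𝓕 (𝓕 triangle) ξ • (Set.Ioc (-(1 / 2) : ℝ) (1 / 2)).indicator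
      (fun _ => (1 : ℂ)) ξ = 3 / 4 := by
    rw [← integral_triangle_center, intervalIntegral.integral_of_le (by norm_num),
      ← integral_indicator measurableSet_Ioc]
    congr 1 with v
    by_cases hv : v ∈ Set.Ioc (-(1 / 2) : ℝ) (1 / 2)
    · rw [Set.indicator_of_mem hv, Set.indicator_of_mem hv, fourier_fourier_triangle, smul_eq_mul,
        mul_one]
    · rw [Set.indicator_of_notMem hv, Set.indicator_of_notMem hv, smul_zero]
  have hr : ∫ x, 𝓕 triangle x • 𝓕 ((Set.Ioc (-(1 / 2) : ℝ) (1 / 2)).indicator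
      (fun _ => (1 : ℂ))) x = ((∫ u : ℝ, sinc (Real.pi * u) ^ 3 : ℝ) : ℂ) := by
    rw [← integral_complex_ofReal]
    refine integral_congr_ae ?_
    filter_upwards [Measure.ae_ne volume (0 : ℝ)] with ξ hξ
    rw [fourier_triangle hξ, fourier_indicator_unit_interval hξ]
    push_cast
    rw [smul_eq_mul]
    ring
  rw [hl, hr] at hflip
  apply Complex.ofReal_injective
  rw [← hflip]
  push_cast
  rfl

theorem measurable_sgn : Measurable sgn :=
  Measurable.ite measurableSet_Ici measurable_const measurable_const

theorem abs_sgn (s : ℝ) : |sgn s| = 1 := by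
  unfold sgn
  split_ifs <;> simp

theorem sgn_neg {s : ℝ} (hs : s ≠ 0) : sgn (-s) = -sgn s := by
  unfold sgn
  rcases lt_or_gt_of_ne hs with h | h
  · rw [if_pos (by linarith), if_neg (by linarith), neg_neg]
  · rw [if_neg (by linarith), if_pos h.le]

theorem norm_sinc_cube_mul_sgn (x s : ℝ) : ‖sinc x ^ 3 * sgn s‖ = ‖sinc x ^ 3‖ := by
  rw [norm_mul, Real.norm_eq_abs (sgn s), abs_sgn, mul_one]

theorem aestronglyMeasurable_sinc_cube_mul_sgn (t : ℝ) :
    AEStronglyMeasurable (fun u : ℝ => sinc (Real.pi * u) ^ 3 * sgn (t - u)) :=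
  (integrable_sinc_pi_mul_pow (by norm_num)).aestronglyMeasurable.mul
    (measurable_sgn.comp (measurable_const.sub measurable_id)).aestronglyMeasurable

theorem integrable_sinc_cube_mul_sgn (t : ℝ) :
    Integrable (fun u : ℝ => sinc (Real.pi * u) ^ 3 * sgn (t - u)) :=
  (integrable_sinc_pi_mul_pow (n := 3) (by norm_num)).mono
    (aestronglyMeasurable_sinc_cube_mul_sgn t)
    (ae_of_all _ fun _ => (norm_sinc_cube_mul_sgn _ _).le)

theorem h₂_eq_integral_comp_sub (t : ℝ) :
    h₂ t = (4 / 3) * ∫ u : ℝ, sinc (Real.pi * u) ^ 3 * sgn (t - u) := by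
  rw [h₂, ← integral_sub_left_eq_self (fun u : ℝ => sinc (Real.pi * u) ^ 3 * sgn (t - u)) volume t]
  simp only [sub_sub_cancel]

theorem h₂_neg (t : ℝ) : h₂ (-t) = -h₂ t := by
  rw [h₂_eq_integral_comp_sub, h₂_eq_integral_comp_sub, ← mul_neg, ← integral_neg,
    ← integral_neg_eq_self]
  congr 1
  refine integral_congr_ae ?_
  filter_upwards [Measure.ae_ne volume t] with u hu
  have h : -t - -u = -(t - u) := by ring
  rw [h, sgn_neg (sub_ne_zero.2 hu.symm), mul_neg, mul_neg, sinc_eq_real_sinc, Real.sinc_neg]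

theorem tendsto_h₂_atTop : Tendsto h₂ atTop (nhds 1) := by
  have h : Tendsto (fun t : ℝ => ∫ u : ℝ, sinc (Real.pi * u) ^ 3 * sgn (t - u)) atTop
      (nhds (∫ u : ℝ, sinc (Real.pi * u) ^ 3)) := by
    refine tendsto_integral_filter_of_dominated_convergence
      (fun u => ‖sinc (Real.pi * u) ^ 3‖)
      (Eventually.of_forall aestronglyMeasurable_sinc_cube_mul_sgn)
      (Eventually.of_forall fun t => ae_of_all _ fun u => (norm_sinc_cube_mul_sgn _ _).le)
      (integrable_sinc_pi_mul_pow (by norm_num)).norm (ae_of_all _ fun u => ?_)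
    refine tendsto_const_nhds.congr' ?_
    filter_upwards [eventually_ge_atTop u] with t ht
    rw [sgn, if_pos (sub_nonneg.2 ht), mul_one]
  rw [integral_sinc_pi_mul_cube] at h
  have h' := h.const_mul (4 / 3)
  norm_num at h'
  exact h'.congr fun t => (h₂_eq_integral_comp_sub t).symm

/-- `h₂` is well defined (the integrand is integrable for every `t`), is an odd
function, and satisfies `h₂(t) → 1` as `t → +∞`. -/
theorem h₂_normalizing :
    (∀ t : ℝ, Integrable (fun s : ℝ => sinc (Real.pi * (t - s)) ^ 3 * sgn s)) ∧
      (∀ t : ℝ, h₂ (-t) = -h₂ t) ∧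
      Tendsto h₂ atTop (nhds 1) := by
  refine ⟨fun t => ?_, h₂_neg, tendsto_h₂_atTop⟩
  simpa only [sub_sub_cancel] using (integrable_sinc_cube_mul_sgn t).comp_sub_left t
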